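/- arXiv:1206.1897 — 2 statements merged into one kernel-verified Lean document; each statement's English description precedes it below -/
import Mathlib

section
/- Let k ≥ 4 be an even integer and let D be a k-quasi-transitive digraph with a unique initial strong component C. Then at least one of the following holds: (1) every vertex of C is a (k+1)-king of D; (2) D has at least one 2-king and at least two 3-kings. -/
variable {V : Type*}

/-- A directed path of length `n` from `u` to `v` in the digraph with arc relation `A`:
a sequence of `n + 1` pairwise distinct vertices, consecutive ones joined by arcs. -/
def HasPathN (A : V → V → Prop) (u v : V) (n : ℕ) : Prop :=
  ∃ f : Fin (n + 1) → V, Function.Injective f ∧ f 0 = u ∧ f (Fin.last n) = v ∧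
    ∀ i : Fin n, A (f i.castSucc) (f i.succ)

/-- The distance from `u` to `v`: the length of a shortest directed path from `u` to `v`,
`⊤` if there is no such path. -/
noncomputable def ddist (A : V → V → Prop) (u v : V) : ℕ∞ :=
  sInf {n : ℕ∞ | ∃ m : ℕ, n = (m : ℕ∞) ∧ HasPathN A u v m}

/-- `D` is `k`-quasi-transitive if for every directed path `(v_0, …, v_k)` of length `k`,
either `(v_0, v_k)` or `(v_k, v_0)` is an arc. -/
def KQuasiTrans (A : V → V → Prop) (k : ℕ) : Prop :=
  ∀ u v : V, HasPathN A u v k → A u v ∨ A v u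

/-- A vertex `v` is an `r`-king if every vertex is within distance `r` from `v`. -/
def IsRKing (A : V → V → Prop) (r : ℕ) (v : V) : Prop :=
  ∀ u : V, ddist A v u ≤ (r : ℕ∞)

/-- `u` reaches `v` by a directed path. -/
def Reaches (A : V → V → Prop) (u v : V) : Prop :=
  ∃ n : ℕ, HasPathN A u v n

/-- A strong component: the set of all vertices mutually reachable with some vertex. -/
def IsStrongComponent (A : V → V → Prop) (S : Set V) : Prop :=
  ∃ v : V, S = {u | Reaches A u v ∧ Reaches A v u}

/-- An initial strong component: a strong component receiving no arcs from outside. -/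
def IsInitialStrongComponent (A : V → V → Prop) (S : Set V) : Prop :=
  IsStrongComponent A S ∧ ∀ u v : V, u ∉ S → v ∈ S → ¬ A u v

/-- The out-degree of `v` in `D`. -/
noncomputable def outDeg (A : V → V → Prop) (v : V) : ℕ :=
  {u : V | A v u}.ncard

/-- The out-degree of `v` in the subdigraph of `D` induced by `C`. -/
noncomputable def outDegIn (A : V → V → Prop) (C : Set V) (v : V) : ℕ :=
  {u ∈ C | A v u}.ncard

/-- The maximum out-degree of the subdigraph induced by `C`. -/
noncomputable def maxOutDegIn (A : V → V → Prop) (C : Set V) : ℕ :=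
  sSup (outDegIn A C '' C)

/-- There is a directed walk of length `n` from `u` to `v`. -/
def HasWalkN (A : V → V → Prop) (u v : V) (n : ℕ) : Prop :=
  ∃ f : ℕ → V, f 0 = u ∧ f n = v ∧ ∀ i < n, A (f i) (f (i + 1))

theorem HasWalkN.refl (A : V → V → Prop) (u : V) : HasWalkN A u u 0 :=
  ⟨fun _ => u, rfl, rfl, by simp⟩

theorem HasWalkN.single {A : V → V → Prop} {u v : V} (h : A u v) : HasWalkN A u v 1 :=
  ⟨fun i => if i = 0 then u else v, by simp, by simp, fun i hi => by
    obtain rfl : i = 0 := by omega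
    simpa using h⟩

theorem HasWalkN.trans {A : V → V → Prop} {u v w : V} {m n : ℕ}
    (h₁ : HasWalkN A u v m) (h₂ : HasWalkN A v w n) : HasWalkN A u w (m + n) := by
  obtain ⟨f, hf0, hfm, hf⟩ := h₁
  obtain ⟨g, hg0, hgn, hg⟩ := h₂
  refine ⟨fun i => if i < m then f i else g (i - m), ?_, ?_, fun i hi => ?_⟩
  · by_cases hm : 0 < m
    · simpa [hm] using hf0
    · obtain rfl : m = 0 := by omega
      simp [hg0, ← hf0, hfm]
  · simpa using hgn
  · by_cases h1 : i + 1 < m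
    · have h2 : i < m := by omega
      simpa [h1, h2] using hf i h2
    · by_cases h2 : i < m
      · obtain rfl : m = i + 1 := by omega
        have := hf i h2
        rw [hfm, ← hg0] at this
        simpa using this
      · have := hg (i - m) (by omega)
        rw [show i - m + 1 = i + 1 - m by omega] at this
        simpa [h1, h2] using this

theorem HasPathN.hasWalkN {A : V → V → Prop} {u v : V} {n : ℕ} (h : HasPathN A u v n) :
    HasWalkN A u v n := by
  obtain ⟨f, -, h0, hn, hA⟩ := h
  refine ⟨fun i => if h : i < n + 1 then f ⟨i, h⟩ else v, ?_, ?_, fun i hi => ?_⟩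
  · simpa using h0
  · simpa [Fin.last] using hn
  · have h1 : i < n + 1 := by omega
    have h2 : i + 1 < n + 1 := by omega
    simpa [h1, h2] using hA ⟨i, hi⟩

theorem HasPathN.of_nat {A : V → V → Prop} {n : ℕ} (f : ℕ → V)
    (hinj : ∀ i j, i < j → j ≤ n → f i ≠ f j) (hA : ∀ i < n, A (f i) (f (i + 1))) :
    HasPathN A (f 0) (f n) n := by
  refine ⟨fun i => f i, fun i j hij => ?_, rfl, rfl, fun i => hA i i.2⟩
  by_contra hne
  rcases lt_or_gt_of_ne hne with h | h
  · exact hinj i j h (by omega) hij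
  · exact hinj j i h (by omega) hij.symm

/-- A walk of minimal length is a path. -/
theorem HasWalkN.hasPathN_of_minimal {A : V → V → Prop} {u v : V} {n : ℕ}
    (h : HasWalkN A u v n) (hmin : ∀ m < n, ¬ HasWalkN A u v m) : HasPathN A u v n := by
  obtain ⟨f, rfl, rfl, hA⟩ := h
  refine HasPathN.of_nat f (fun i j hij hj heq => ?_) hA
  have h₁ : HasWalkN A (f 0) (f i) i := ⟨f, rfl, rfl, fun t ht => hA t (by omega)⟩
  have h₂ : HasWalkN A (f i) (f n) (n - j) :=
    ⟨fun t => f (j + t), heq.symm, by simp only; congr 1; omega, fun t ht => hA _ (by omega)⟩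
  exact hmin _ (by omega) (h₁.trans h₂)

theorem HasWalkN.exists_hasPathN {A : V → V → Prop} {u v : V} {n : ℕ}
    (h : HasWalkN A u v n) : ∃ m ≤ n, HasPathN A u v m := by
  classical
  have hex : ∃ n, HasWalkN A u v n := ⟨n, h⟩
  exact ⟨Nat.find hex, Nat.find_min' hex h,
    (Nat.find_spec hex).hasPathN_of_minimal fun m hm => Nat.find_min hex hm⟩

theorem HasWalkN.ddist_le {A : V → V → Prop} {u v : V} {n r : ℕ}
    (h : HasWalkN A u v n) (hr : n ≤ r) : ddist A u v ≤ (r : ℕ∞) := by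
  obtain ⟨m, hm, hp⟩ := h.exists_hasPathN
  have hle : ddist A u v ≤ (m : ℕ∞) := sInf_le ⟨m, rfl, hp⟩
  exact hle.trans (by exact_mod_cast hm.trans hr)

theorem reaches_iff_exists_hasWalkN {A : V → V → Prop} {u v : V} :
    Reaches A u v ↔ ∃ n, HasWalkN A u v n :=
  ⟨fun ⟨n, h⟩ => ⟨n, h.hasWalkN⟩, fun ⟨_, h⟩ =>
    let ⟨m, _, hp⟩ := h.exists_hasPathN
    ⟨m, hp⟩⟩

theorem Reaches.refl (A : V → V → Prop) (u : V) : Reaches A u u :=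
  reaches_iff_exists_hasWalkN.2 ⟨0, .refl A u⟩

theorem Reaches.single {A : V → V → Prop} {u v : V} (h : A u v) : Reaches A u v :=
  reaches_iff_exists_hasWalkN.2 ⟨1, .single h⟩

theorem Reaches.trans {A : V → V → Prop} {u v w : V} (h₁ : Reaches A u v)
    (h₂ : Reaches A v w) : Reaches A u w := by
  rw [reaches_iff_exists_hasWalkN] at *
  obtain ⟨m, hm⟩ := h₁
  obtain ⟨n, hn⟩ := h₂
  exact ⟨m + n, hm.trans hn⟩

/-- If the initial strong component is unique, each of its vertices reaches every vertex. -/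
theorem reaches_of_mem_unique_initial [Finite V] {A : V → V → Prop} {C : Set V}
    (huniq : ∀ S : Set V, IsInitialStrongComponent A S → S = C) {c : V} (hc : c ∈ C) (y : V) :
    Reaches A c y := by
  obtain ⟨w, hwy, hmin⟩ := Set.exists_min_image {w | Reaches A w y}
    (fun w => {a | Reaches A a w}.ncard) (Set.toFinite _) ⟨y, Reaches.refl A y⟩
  have hback : ∀ a, Reaches A a w → Reaches A w a := by
    intro a ha
    by_contra hwa
    have hlt : {b | Reaches A b a}.ncard < {b | Reaches A b w}.ncard := by
      refine Set.ncard_lt_ncard ?_ (Set.toFinite _)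
      refine (Set.ssubset_iff_of_subset fun b hb => Reaches.trans hb ha).2 ?_
      exact ⟨w, Reaches.refl A w, hwa⟩
    exact absurd (hmin a (ha.trans hwy)) (by simpa using hlt)
  have hS := huniq {u | Reaches A u w ∧ Reaches A w u} ⟨⟨w, rfl⟩, fun u v hu hv huv => by
    have huw : Reaches A u w := (Reaches.single huv).trans hv.1
    exact hu ⟨huw, hback u huw⟩⟩
  rw [← hS] at hc
  exact hc.1.trans hwy

/-- `d` satisfies the local conditions of the distance function from `s`. -/
structure IsLevelFn (A : V → V → Prop) (s : V) (d : V → ℕ) : Prop where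
  source : ∀ u, d u = 0 ↔ u = s
  le_succ : ∀ u v, A u v → d v ≤ d u + 1
  exists_pred : ∀ u n, d u = n + 1 → ∃ w, d w = n ∧ A w u

theorem exists_isLevelFn {A : V → V → Prop} {s : V} (hs : ∀ u, Reaches A s u) :
    ∃ d : V → ℕ, IsLevelFn A s d ∧ ∀ u, HasWalkN A s u (d u) := by
  classical
  have hex : ∀ u, ∃ n, HasWalkN A s u n := fun u => reaches_iff_exists_hasWalkN.1 (hs u)
  refine ⟨fun u => Nat.find (hex u), ⟨fun u => ?_, fun u v huv => ?_, fun u n hn => ?_⟩,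
    fun u => Nat.find_spec (hex u)⟩
  · rw [Nat.find_eq_zero]
    constructor
    · rintro ⟨f, h0, h1, -⟩
      exact h1.symm.trans h0
    · rintro rfl
      exact .refl A u
  · exact Nat.find_min' _ ((Nat.find_spec (hex u)).trans (.single huv))
  · obtain ⟨f, h0, h1, hA⟩ := Nat.find_spec (hex u)
    rw [hn] at h1 hA
    have hlast : A (f n) u := h1 ▸ hA n (by omega)
    have hle : Nat.find (hex (f n)) ≤ n :=
      Nat.find_min' _ ⟨f, h0, rfl, fun i hi => hA i (by omega)⟩
    have hge : Nat.find (hex u) ≤ Nat.find (hex (f n)) + 1 :=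
      Nat.find_min' _ ((Nat.find_spec (hex (f n))).trans (.single hlast))
    exact ⟨f n, by omega, hlast⟩

/-- The sequence `z` climbs one level at a time along arcs, up to level `m`. -/
def IsGeodesic (A : V → V → Prop) (d : V → ℕ) (m : ℕ) (z : ℕ → V) : Prop :=
  (∀ i ≤ m, d (z i) = i) ∧ ∀ i < m, A (z i) (z (i + 1))

theorem IsLevelFn.exists_geodesic {A : V → V → Prop} {s : V} {d : V → ℕ}
    (hd : IsLevelFn A s d) (u : V) : ∃ z, IsGeodesic A d (d u) z ∧ z (d u) = u := by
  suffices h : ∀ n u, d u = n → ∃ z, IsGeodesic A d n z ∧ z n = u from h _ u rfl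
  intro n
  induction n with
  | zero => exact fun u hu => ⟨fun _ => u, ⟨fun i hi => by simp only; omega, fun i hi => by omega⟩, rfl⟩
  | succ n ih =>
    intro u hu
    obtain ⟨w, hw, hwu⟩ := hd.exists_pred u n hu
    obtain ⟨z, ⟨hz, hzA⟩, hzn⟩ := ih w hw
    refine ⟨fun i => if i ≤ n then z i else u, ⟨fun i hi => ?_, fun i hi => ?_⟩, by simp⟩
    · by_cases h : i ≤ n
      · simpa [h] using hz i h
      · obtain rfl : i = n + 1 := by omega
        simpa using hu
    · by_cases h : i < n
      · have h' : i ≤ n := h.le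
        have h'' : i + 1 ≤ n := h
        simpa [h', h''] using hzA i h
      · obtain rfl : i = n := by omega
        simpa [hzn] using hwu

section

variable {A : V → V → Prop} {k : ℕ} {d : V → ℕ}

/-- The path `v → z_r → ⋯ → z_t` of length `k`. -/
theorem KQuasiTrans.adj_of_segment (hqt : KQuasiTrans A k) {m r t : ℕ} {z : ℕ → V} {v : V}
    (hz : IsGeodesic A d m z) (htm : t ≤ m) (hlen : r + k = t + 1) (hk : 1 ≤ k)
    (hv : ∀ i, r ≤ i → i ≤ t → v ≠ z i) (hA : A v (z r)) : A v (z t) ∨ A (z t) v := by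
  have hp := HasPathN.of_nat (A := A) (n := k) (fun i => if i = 0 then v else z (r + i - 1))
    (fun i j hij hj => ?_) (fun i hi => ?_)
  · have hk0 : k ≠ 0 := by omega
    have := hqt _ _ hp
    simpa [hk0, show r + k - 1 = t by omega] using this
  · have hj0 : j ≠ 0 := by omega
    by_cases hi0 : i = 0
    · simpa [hi0, hj0] using hv (r + j - 1) (by omega) (by omega)
    · simp only [hi0, hj0, if_false]
      intro h
      have h1 := hz.1 (r + i - 1) (by omega)
      have h2 := hz.1 (r + j - 1) (by omega)
      rw [h] at h1
      omega
  · by_cases hi0 : i = 0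
    · simpa [hi0] using hA
    · have := hz.2 (r + i - 1) (by omega)
      rw [show r + i - 1 + 1 = r + (i + 1) - 1 by omega] at this
      simpa [hi0] using this

/-- The path `v → x_p → ⋯ → x_q → z_r → ⋯ → z_t` of length `k`. -/
theorem KQuasiTrans.adj_of_two_segments (hqt : KQuasiTrans A k) {m m' p q r t : ℕ}
    {x z : ℕ → V} {v : V} (hx : IsGeodesic A d m x) (hz : IsGeodesic A d m' z)
    (hqm : q ≤ m) (htm : t ≤ m') (hpq : p ≤ q) (hrt : r ≤ t) (htp : t < p) (hv : q < d v)
    (hlen : q - p + (t - r) + 2 = k) (hA : A v (x p)) (hA' : A (x q) (z r)) :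
    A v (z t) ∨ A (z t) v := by
  set s := q - p + 1 with hs
  set f : ℕ → V := fun i => if i = 0 then v else if i ≤ s then x (p + i - 1)
    else z (r + i - s - 1) with hf
  have hf0 : f 0 = v := by simp [hf]
  have hfx : ∀ i, 1 ≤ i → i ≤ s → f i = x (p + i - 1) := fun i h1 h2 => by
    simp [hf, h2, show i ≠ 0 by omega]
  have hfz : ∀ i, s < i → f i = z (r + i - s - 1) := fun i h => by
    simp [hf, show ¬ i ≤ s by omega, show i ≠ 0 by omega]
  have hdx : ∀ i, 1 ≤ i → i ≤ s → d (f i) = p + i - 1 := fun i h1 h2 => by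
    rw [hfx i h1 h2, hx.1 _ (by omega)]
  have hdz : ∀ i, s < i → i ≤ k → d (f i) = r + i - s - 1 := fun i h h2 => by
    rw [hfz i h, hz.1 _ (by omega)]
  have hp := HasPathN.of_nat (A := A) (n := k) f (fun i j hij hj h => ?_) (fun i hi => ?_)
  · have := hqt _ _ hp
    rwa [hf0, hfz k (by omega), show r + k - s - 1 = t by omega] at this
  · have h' := congrArg d h
    rcases Nat.eq_zero_or_pos i with rfl | hi
    · rw [hf0] at h'
      rcases le_or_gt j s with hjs | hjs
      · rw [hdx j (by omega) hjs] at h'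
        omega
      · rw [hdz j hjs hj] at h'
        omega
    · rcases le_or_gt j s with hjs | hjs
      · rw [hdx i hi (by omega), hdx j (by omega) hjs] at h'
        omega
      · rw [hdz j hjs hj] at h'
        rcases le_or_gt i s with his | his
        · rw [hdx i hi his] at h'
          omega
        · rw [hdz i his (by omega)] at h'
          omega
  · rcases Nat.eq_zero_or_pos i with rfl | hi0
    · rw [hf0, hfx _ le_rfl (by omega)]
      simpa using hA
    · rcases lt_trichotomy i s with his | his | his
      · rw [hfx i hi0 his.le, hfx (i + 1) (by omega) his,
          show p + (i + 1) - 1 = p + i - 1 + 1 by omega]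
        exact hx.2 _ (by omega)
      · rw [hfx i hi0 his.le, hfz (i + 1) (by omega), show p + i - 1 = q by omega,
          show r + (i + 1) - s - 1 = r by omega]
        exact hA'
      · rw [hfz i his, hfz (i + 1) (by omega), show r + (i + 1) - s - 1 = r + i - s - 1 + 1 by omega]
        exact hz.2 _ (by omega)

variable {s : V}

theorem IsLevelFn.arc_of_adj (hd : IsLevelFn A s d) {u v : V} (h : A v u ∨ A u v)
    (hlt : d u + 2 ≤ d v) : A v u := by
  refine h.resolve_right fun h' => ?_
  have := hd.le_succ u v h'
  omega

theorem KQuasiTrans.geodesic_back (hqt : KQuasiTrans A k) (hk : 2 ≤ k) (hd : IsLevelFn A s d)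
    {m i : ℕ} {x : ℕ → V} (hx : IsGeodesic A d m x) (hi : i + k ≤ m) : A (x (i + k)) (x i) := by
  have hp := HasPathN.of_nat (A := A) (n := k) (fun j => x (i + j))
    (fun a b hab hb h => ?_) (fun j hj => hx.2 _ (by omega))
  · refine hd.arc_of_adj (by simpa using (hqt _ _ hp).symm) ?_
    rw [hx.1 _ (by omega), hx.1 _ (by omega)]
    omega
  · have h1 := hx.1 (i + a) (by omega)
    have h2 := hx.1 (i + b) (by omega)
    rw [show x (i + a) = x (i + b) from h] at h1
    omega

/-- The end of a geodesic of length at least `k + 2` dominates all of it but its predecessor. -/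
theorem KQuasiTrans.geodesic_end_dominates (hqt : KQuasiTrans A k) (hk : 4 ≤ k) (hke : Even k)
    (hd : IsLevelFn A s d) {m : ℕ} {x : ℕ → V} (hx : IsGeodesic A d m x) (hm : k + 2 ≤ m) :
    ∀ i, i + 2 ≤ m → A (x m) (x i) := by
  obtain ⟨o, rfl⟩ : ∃ o, m = o + k + 2 := ⟨m - k - 2, by omega⟩
  have hdv : d (x (o + k + 2)) = o + k + 2 := hx.1 _ le_rfl
  have hdir : ∀ i, i ≤ o + k → A (x (o + k + 2)) (x i) ∨ A (x i) (x (o + k + 2)) →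
      A (x (o + k + 2)) (x i) := fun i hi h => hd.arc_of_adj h (by
    rw [hdv, hx.1 i (by omega)]
    omega)
  have hne : ∀ i, i ≤ o + k → x (o + k + 2) ≠ x i := fun i hi h => by
    have := congrArg d h
    rw [hdv, hx.1 i (by omega)] at this
    omega
  have hback : ∀ i, i ≤ o → A (x (i + k)) (x i) := fun i hi =>
    hqt.geodesic_back (by omega) hd hx (by omega)
  have h2 : A (x (o + k + 2)) (x (o + 2)) := by
    have := hqt.geodesic_back (by omega) hd hx (i := o + 2) (by omega)
    rwa [show o + 2 + k = o + k + 2 by omega] at this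
  have hdown : ∀ j, j + 2 ≤ k → A (x (o + k + 2)) (x (o + (j + 2))) →
      A (x (o + k + 2)) (x (o + j)) := fun j hj h =>
    hdir _ (by omega) (hqt.adj_of_two_segments hx hx (q := o + k) (r := o) (by omega) (by omega)
      (by omega) (by omega) (by omega) (by omega) (by omega) h (hback o le_rfl))
  have hdowns : ∀ n j, j + 2 * n ≤ k → A (x (o + k + 2)) (x (o + (j + 2 * n))) →
      A (x (o + k + 2)) (x (o + j)) := by
    intro n
    induction n with
    | zero => exact fun j _ h => h
    | succ n ih => exact fun j hj h => ih j (by omega) (hdown _ (by omega) h)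
  have h0 : A (x (o + k + 2)) (x o) := hdown 0 (by omega) h2
  have hsub : A (x (o + k + 2)) (x (o + (k - 1))) :=
    hdir _ (by omega) (hqt.adj_of_segment hx (by omega) (by omega) (by omega)
      (fun i _ hi => hne i (by omega)) h0)
  obtain ⟨l, hl⟩ := hke
  have h1 : A (x (o + k + 2)) (x (o + 1)) := by
    refine hdowns (l - 1) 1 (by omega) ?_
    rwa [show 1 + 2 * (l - 1) = k - 1 by omega]
  have hkk : A (x (o + k + 2)) (x (o + k)) :=
    hdir _ (by omega) (hqt.adj_of_segment hx (by omega) (by omega) (by omega)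
      (fun i _ hi => hne i (by omega)) h1)
  have hwin : ∀ j, j ≤ k → A (x (o + k + 2)) (x (o + j)) := by
    intro j hj
    obtain ⟨t, ht | ht⟩ := Nat.even_or_odd' j
    · refine hdowns (l - t) j (by omega) ?_
      rwa [show j + 2 * (l - t) = k by omega]
    · refine hdowns (l - 1 - t) j (by omega) ?_
      rwa [show j + 2 * (l - 1 - t) = k - 1 by omega]
  have hlow : ∀ n i, n + i = o → A (x (o + k + 2)) (x i) := by
    intro n
    induction n using Nat.strong_induction_on with
    | _ n ih =>
      intro i hi
      rcases Nat.eq_zero_or_pos n with rfl | hn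
      · obtain rfl : i = o := by omega
        exact h0
      · have hprev : A (x (o + k + 2)) (x (i + 2)) := by
          rcases le_or_gt (i + 2) o with h | h
          · exact ih (n - 2) (by omega) _ (by omega)
          · have := hwin (i + 2 - o) (by omega)
            rwa [show o + (i + 2 - o) = i + 2 by omega] at this
        exact hdir _ (by omega) (hqt.adj_of_two_segments hx hx (q := i + k) (r := i) (by omega)
          (by omega) (by omega) le_rfl (by omega) (by omega) (by omega) hprev
          (hback i (by omega)))
  intro i hi
  rcases le_or_gt i o with h | h
  · exact hlow (o - i) i (by omega)
  · have := hwin (i - o) (by omega)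
    rwa [show o + (i - o) = i by omega] at this

/-- A vertex at level at least `k + 2` dominates every vertex at least two levels below. -/
theorem KQuasiTrans.dominates_lower_levels (hqt : KQuasiTrans A k) (hk : 4 ≤ k) (hke : Even k)
    (hd : IsLevelFn A s d) {v : V} (hv : k + 2 ≤ d v) :
    ∀ u, d u + 2 ≤ d v → A v u := by
  obtain ⟨x, hx, hxv⟩ := hd.exists_geodesic v
  have hdom := hqt.geodesic_end_dominates hk hke hd hx hv
  rw [hxv] at hdom
  have hx0 : x 0 = s := (hd.source _).1 (hx.1 0 (by omega))
  intro u
  induction hj : d u using Nat.strong_induction_on generalizing u with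
  | _ j ih =>
    intro hu
    obtain ⟨z, hz, hzu⟩ := hd.exists_geodesic u
    have hz0 : z 0 = s := (hd.source _).1 (hz.1 0 (by omega))
    rw [hj] at hz hzu
    refine hd.arc_of_adj ?_ (by omega)
    rw [← hzu]
    rcases le_or_gt (k - 1) j with hjk | hjk
    · refine hqt.adj_of_segment hz le_rfl (r := j + 1 - k) (by omega) (by omega)
        (fun i _ hi h => ?_) ?_
      · have := congrArg d h
        rw [hz.1 i hi] at this
        omega
      · exact ih (j + 1 - k) (by omega) _ (hz.1 _ (by omega)) (by omega)
    · refine hqt.adj_of_two_segments hx hz (p := j + 2) (q := k) (r := 0) (by omega) le_rfl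
        (by omega) (by omega) (by omega) (by omega) (by omega) (hdom _ (by omega)) ?_
      rw [hz0, ← hx0]
      simpa using hqt.geodesic_back (by omega) hd hx (i := 0) (by omega)

/-- Two distinct vertices at the same level, at least `k + 2`, are adjacent. -/
theorem KQuasiTrans.adj_of_same_level (hqt : KQuasiTrans A k) (hk : 4 ≤ k) (hke : Even k)
    (hd : IsLevelFn A s d) {u v : V} (hv : k + 2 ≤ d v) (huv : d u = d v) (hne : v ≠ u) :
    A v u ∨ A u v := by
  obtain ⟨z, hz, hzu⟩ := hd.exists_geodesic u
  have := hqt.adj_of_segment hz le_rfl (r := d u + 1 - k) (v := v) (by omega) (by omega)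
    (fun i _ hi h => ?_) ?_
  · rwa [hzu] at this
  · rcases hi.eq_or_lt with rfl | hi'
    · exact hne (h.trans hzu)
    · have := congrArg d h
      rw [hz.1 i hi] at this
      omega
  · exact hqt.dominates_lower_levels hk hke hd hv _ (by rw [hz.1 _ (by omega)]; omega)

end

/-- In a finite set whose distinct members are pairwise adjacent, some member reaches all the
others within two steps. -/
theorem exists_two_king_of_semicomplete [Finite V] {A : V → V → Prop}
    (hloop : ∀ v, ¬ A v v) {S : Set V} (hne : S.Nonempty)
    (hadj : ∀ u ∈ S, ∀ v ∈ S, u ≠ v → A u v ∨ A v u) :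
    ∃ v ∈ S, ∀ u ∈ S, u ≠ v → A v u ∨ ∃ w, A v w ∧ A w u := by
  obtain ⟨v, hv, hmax⟩ := Set.exists_max_image S (outDegIn A S) (Set.toFinite _) hne
  refine ⟨v, hv, fun u hu huv => ?_⟩
  by_contra! ⟨hvu, hno⟩
  have huv' : A u v := (hadj u hu v hv huv).resolve_right hvu
  refine absurd (hmax u hu) (not_le.2 (Set.ncard_lt_ncard ?_ (Set.toFinite _)))
  have hsub : {w ∈ S | A v w} ⊆ {w ∈ S | A u w} := fun w hw =>
    have hwu : u ≠ w := fun h => hvu (h ▸ hw.2)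
    ⟨hw.1, (hadj u hu w hw.1 hwu).resolve_right (hno w hw.2)⟩
  exact (Set.ssubset_iff_of_subset hsub).2 ⟨v, ⟨hv, huv'⟩, fun h => hloop v h.2⟩

/-- even `k ≥ 4`, unique initial strong component `C`; either every vertex
of `C` is a `(k+1)`-king, or `D` has a `2`-king and at least two `3`-kings. -/
theorem kqt_even_main
    [Fintype V] (A : V → V → Prop) (hloop : ∀ v : V, ¬ A v v)
    (k : ℕ) (hk : 4 ≤ k) (hke : Even k) (hqt : KQuasiTrans A k)
    (C : Set V) (hC : IsInitialStrongComponent A C)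
    (huniq : ∀ S : Set V, IsInitialStrongComponent A S → S = C) :
    (∀ v ∈ C, IsRKing A (k + 1) v) ∨
      ((∃ v : V, IsRKing A 2 v) ∧ 2 ≤ {v : V | IsRKing A 3 v}.ncard) := by
  rw [or_iff_not_imp_left]
  intro hnot
  push Not at hnot
  obtain ⟨s, hsC, hs⟩ := hnot
  obtain ⟨d, hd, hwalk⟩ := exists_isLevelFn (reaches_of_mem_unique_initial huniq hsC)
  obtain ⟨y, hy⟩ : ∃ y, k + 2 ≤ d y := by
    by_contra! h
    exact hs fun u => (hwalk u).ddist_le (by have := h u; omega)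
  obtain ⟨t, -, hmax⟩ := Set.exists_max_image Set.univ d (Set.toFinite _) ⟨y, trivial⟩
  have ht : k + 2 ≤ d t := hy.trans (hmax y trivial)
  obtain ⟨v, hvt, hv⟩ := exists_two_king_of_semicomplete hloop (S := {u | d u = d t}) ⟨t, rfl⟩
    fun u (hu : d u = d t) w (hw : d w = d t) hne =>
      hqt.adj_of_same_level hk hke hd (by omega) (by omega) hne
  replace hvt : d v = d t := hvt
  have hdom := hqt.dominates_lower_levels hk hke hd (v := v) (by omega)
  have hwalk₂ : ∀ u, ∃ n ≤ 2, HasWalkN A v u n := by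
    intro u
    have hut := hmax u trivial
    rcases eq_or_ne u v with rfl | huv
    · exact ⟨0, by omega, .refl A u⟩
    rcases le_or_gt (d u + 2) (d v) with h | h
    · exact ⟨1, by omega, .single (hdom u h)⟩
    rcases hut.eq_or_lt with h' | h'
    · rcases hv u h' huv with h'' | ⟨w, hvw, hwu⟩
      · exact ⟨1, by omega, .single h''⟩
      · exact ⟨2, le_rfl, (HasWalkN.single hvw).trans (.single hwu)⟩
    · obtain ⟨w, hw, hwu⟩ := hd.exists_pred u (d u - 1) (by omega)
      exact ⟨2, le_rfl, (HasWalkN.single (hdom w (by omega))).trans (.single hwu)⟩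
  obtain ⟨w, -, hwv⟩ := hd.exists_pred v (d v - 1) (by omega)
  refine ⟨⟨v, fun u => ?_⟩, ?_⟩
  · obtain ⟨n, hn, h⟩ := hwalk₂ u
    exact h.ddist_le hn
  · have hne : v ≠ w := fun h => hloop v (by rwa [← h] at hwv)
    rw [← Set.ncard_pair hne]
    refine Set.ncard_le_ncard ?_ (Set.toFinite _)
    rintro a (rfl | rfl) u
    · obtain ⟨n, hn, h⟩ := hwalk₂ u
      exact h.ddist_le (by omega)
    · obtain ⟨n, hn, h⟩ := hwalk₂ u
      exact ((HasWalkN.single hwv).trans h).ddist_le (by omega)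
end

section
/- Let k ≥ 3 be an odd integer and let D be a k-quasi-transitive digraph with a unique initial strong component C. Then at least one of the following holds: (1) every vertex of C is a (k+1)-king of D; (2) if no vertex of C is a 3-king of D, then D has at least four 4-kings. -/
variable {V : Type*}

/-- `v` can be reached from `u` by a directed walk of length at most `n`. -/
def WalkLe (A : V → V → Prop) : ℕ → V → V → Prop
  | 0, u, v => u = v
  | n + 1, u, v => WalkLe A n u v ∨ ∃ w, WalkLe A n u w ∧ A w v

namespace WalkLe

variable {A : V → V → Prop}

lemma refl (n : ℕ) (u : V) : WalkLe A n u u := by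
  induction n with
  | zero => rfl
  | succ n ih => exact Or.inl ih

lemma tail {n : ℕ} {u v w : V} (h : WalkLe A n u v) (hvw : A v w) : WalkLe A (n + 1) u w :=
  Or.inr ⟨v, h, hvw⟩

lemma mono {m n : ℕ} (hmn : m ≤ n) {u v : V} (h : WalkLe A m u v) : WalkLe A n u v := by
  induction n, hmn using Nat.le_induction with
  | base => exact h
  | succ n _ ih => exact Or.inl ih

lemma head {n : ℕ} {u v w : V} (huv : A u v) (h : WalkLe A n v w) : WalkLe A (n + 1) u w := by
  induction n generalizing w with
  | zero => obtain rfl : v = w := h; exact tail (refl 0 u) huv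
  | succ n ih =>
    rcases h with h | ⟨z, hz, hzw⟩
    · exact Or.inl (ih h)
    · exact tail (ih hz) hzw

lemma single {u v : V} (h : A u v) : WalkLe A 1 u v := tail (refl 0 u) h

end WalkLe

/-- Paths of length `n`, with vertices indexed by natural numbers. -/
lemma hasPathN_iff_nat {A : V → V → Prop} {u v : V} {n : ℕ} :
    HasPathN A u v n ↔ ∃ p : ℕ → V, Set.InjOn p (Set.Iic n) ∧ p 0 = u ∧ p n = v ∧
      ∀ i < n, A (p i) (p (i + 1)) := by
  constructor
  · rintro ⟨f, hf, h0, hn, ha⟩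
    refine ⟨fun i => f (Fin.ofNat (n + 1) i), ?_, ?_, ?_, ?_⟩
    · intro i hi j hj hij
      have := congrArg Fin.val (hf hij)
      simp only [Set.mem_Iic] at hi hj
      simpa [Fin.ofNat, Nat.mod_eq_of_lt (Nat.lt_succ_of_le hi),
        Nat.mod_eq_of_lt (Nat.lt_succ_of_le hj)] using this
    · rw [← h0]; congr 1
    · rw [← hn]
      exact congrArg f (Fin.ext (by simp [Fin.ofNat]))
    · intro i hi
      convert ha ⟨i, hi⟩ using 2
      · ext; simp [Fin.ofNat]; omega
      · ext; simp [Fin.ofNat]; omega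
  · rintro ⟨p, hp, h0, hn, ha⟩
    refine ⟨fun i => p i, ?_, h0, hn, fun i => ha i i.2⟩
    intro i j hij
    exact Fin.ext (hp (Set.mem_Iic.2 (Nat.le_of_lt_succ i.2))
      (Set.mem_Iic.2 (Nat.le_of_lt_succ j.2)) hij)

lemma WalkLe.exists_path {A : V → V → Prop} {n : ℕ} {u v : V} (h : WalkLe A n u v) :
    ∃ m ≤ n, HasPathN A u v m := by
  induction n generalizing v with
  | zero =>
    obtain rfl : u = v := h
    exact ⟨0, le_rfl, hasPathN_iff_nat.2 ⟨fun _ => u, by intro i hi j hj _; simp_all, rfl, rfl,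
      by simp⟩⟩
  | succ n ih =>
    rcases h with h | ⟨w, hw, hwv⟩
    · obtain ⟨m, hm, h⟩ := ih h
      exact ⟨m, by omega, h⟩
    · obtain ⟨m, hm, h⟩ := ih hw
      obtain ⟨p, hp, h0, hn, ha⟩ := hasPathN_iff_nat.1 h
      by_cases hv : ∃ i ≤ m, p i = v
      · obtain ⟨i, hi, rfl⟩ := hv
        exact ⟨i, by omega, hasPathN_iff_nat.2 ⟨p, hp.mono (Set.Iic_subset_Iic.2 hi), h0, rfl,
          fun j hj => ha j (by omega)⟩⟩
      · push Not at hv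
        refine ⟨m + 1, by omega, hasPathN_iff_nat.2
          ⟨fun i => if i ≤ m then p i else v, ?_, by simpa using h0, by simp, ?_⟩⟩
        · intro i hi j hj hij
          simp only [Set.mem_Iic] at hi hj
          simp only at hij
          split_ifs at hij with h1 h2 h2
          · exact hp h1 h2 hij
          · exact absurd hij (hv i h1)
          · exact absurd hij.symm (hv j h2)
          · omega
        · intro i hi
          rcases Nat.lt_or_ge i m with h1 | h1
          · simpa [h1.le, Nat.succ_le_of_lt h1] using ha i h1
          · obtain rfl : i = m := by omega
            simpa [hn] using hwv

lemma HasPathN.walkLe {A : V → V → Prop} {n : ℕ} {u v : V} (h : HasPathN A u v n) :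
    WalkLe A n u v := by
  obtain ⟨p, -, h0, hn, ha⟩ := hasPathN_iff_nat.1 h
  have : ∀ i ≤ n, WalkLe A i u (p i) := by
    intro i
    induction i with
    | zero => intro _; exact h0 ▸ WalkLe.refl 0 _
    | succ i ih => intro hi; exact (ih (by omega)).tail (ha i (by omega))
  exact hn ▸ this n le_rfl

lemma ddist_le_iff_walkLe {A : V → V → Prop} {n : ℕ} {u v : V} :
    ddist A u v ≤ (n : ℕ∞) ↔ WalkLe A n u v := by
  constructor
  · intro h
    have hne : {n : ℕ∞ | ∃ m : ℕ, n = (m : ℕ∞) ∧ HasPathN A u v m}.Nonempty := by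
      by_contra hne
      rw [Set.not_nonempty_iff_eq_empty] at hne
      simp [ddist, hne] at h
    obtain ⟨m, hm, hp⟩ := csInf_mem hne
    have hmn : m ≤ n := by
      unfold ddist at h
      rw [hm] at h
      exact_mod_cast h
    exact hp.walkLe.mono hmn
  · intro h
    obtain ⟨m, hm, hp⟩ := h.exists_path
    exact le_trans (sInf_le ⟨m, rfl, hp⟩) (Nat.cast_le.2 hm : (m : ℕ∞) ≤ n)

lemma isRKing_iff_walkLe {A : V → V → Prop} {r : ℕ} {v : V} :
    IsRKing A r v ↔ ∀ u, WalkLe A r v u :=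
  forall_congr' fun _ => ddist_le_iff_walkLe

lemma reaches_iff_reflTransGen {A : V → V → Prop} {u v : V} :
    Reaches A u v ↔ Relation.ReflTransGen A u v := by
  constructor
  · rintro ⟨n, h⟩
    have := h.walkLe
    clear h
    induction n generalizing v with
    | zero => obtain rfl : u = v := this; exact .refl
    | succ n ih =>
      rcases this with h | ⟨w, hw, hwv⟩
      · exact ih h
      · exact (ih hw).tail hwv
  · intro h
    have : ∃ n, WalkLe A n u v := by
      induction h with
      | refl => exact ⟨0, rfl⟩
      | tail _ hbc ih => obtain ⟨n, hn⟩ := ih; exact ⟨n + 1, hn.tail hbc⟩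
    obtain ⟨n, hn⟩ := this
    obtain ⟨m, -, hm⟩ := hn.exists_path
    exact ⟨m, hm⟩

/-- In a finite digraph every vertex is reachable from some initial strong component. -/
lemma exists_initial_reaching [Finite V] (A : V → V → Prop) (u : V) :
    ∃ S, IsInitialStrongComponent A S ∧ ∃ s ∈ S, ∀ w ∈ S, Relation.ReflTransGen A w u := by
  let anc : V → Set V := fun v => {w | Relation.ReflTransGen A w v}
  obtain ⟨s, hs, hmin⟩ := Set.exists_min_image (anc u) (fun v => (anc v).ncard)
    (Set.toFinite _) ⟨u, .refl⟩
  have hback : ∀ w ∈ anc s, Relation.ReflTransGen A s w := by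
    intro w hw
    have hsub : anc w ⊆ anc s := fun z hz => Relation.ReflTransGen.trans hz hw
    have := Set.eq_of_subset_of_ncard_le hsub (hmin w (Relation.ReflTransGen.trans hw hs))
      (Set.toFinite _)
    have hmem : s ∈ anc s := .refl
    rw [← this] at hmem
    exact hmem
  refine ⟨{w | Reaches A w s ∧ Reaches A s w}, ⟨⟨s, rfl⟩, ?_⟩, s, ?_, ?_⟩
  · intro w v hw hv hwv
    simp only [Set.mem_ofPred_eq, reaches_iff_reflTransGen] at hw hv
    have : w ∈ anc s := Relation.ReflTransGen.head hwv hv.1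
    exact hw ⟨this, hback w this⟩
  · simp only [Set.mem_ofPred_eq, reaches_iff_reflTransGen]
    exact ⟨.refl, .refl⟩
  · intro w hw
    simp only [Set.mem_ofPred_eq, reaches_iff_reflTransGen] at hw
    exact hw.1.trans hs

/-- `ρ` is the distance from the vertex set `S`, in a digraph where `S` reaches everything. -/
structure IsLayering (A : V → V → Prop) (S : Set V) (ρ : V → ℕ) : Prop where
  zero_iff : ∀ w, ρ w = 0 ↔ w ∈ S
  step : ∀ {u v}, A u v → ρ v ≤ ρ u + 1
  pred : ∀ {w j}, ρ w = j + 1 → ∃ u, A u w ∧ ρ u = j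

lemma exists_isLayering (A : V → V → Prop) (S : Set V)
    (h : ∀ w, ∃ s ∈ S, Relation.ReflTransGen A s w) : ∃ ρ, IsLayering A S ρ := by
  classical
  have hex : ∀ w, ∃ n, ∃ s ∈ S, WalkLe A n s w := by
    intro w
    obtain ⟨s, hs, hw⟩ := h w
    obtain ⟨n, hn⟩ := reaches_iff_reflTransGen.2 hw
    exact ⟨n, s, hs, hn.walkLe⟩
  refine ⟨fun w => Nat.find (hex w), ?_, ?_, ?_⟩
  · intro w
    rw [Nat.find_eq_zero]
    exact ⟨fun ⟨s, hs, (e : s = w)⟩ => e ▸ hs, fun hw => ⟨w, hw, rfl⟩⟩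
  · intro u v huv
    obtain ⟨s, hs, hw⟩ := Nat.find_spec (hex u)
    exact Nat.find_min' _ ⟨s, hs, hw.tail huv⟩
  · intro w j hj
    obtain ⟨s, hs, hw⟩ := Nat.find_spec (hex w)
    have hmin := fun m => @Nat.find_min _ _ (hex w) m
    rw [hj] at hw hmin
    rcases hw with hw | ⟨u, hu, huw⟩
    · exact absurd ⟨s, hs, hw⟩ (hmin j (by omega))
    · refine ⟨u, huw, le_antisymm (Nat.find_min' _ ⟨s, hs, hu⟩) ?_⟩
      by_contra hlt
      push Not at hlt
      obtain ⟨s', hs', hu'⟩ := Nat.find_spec (hex u)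
      exact hmin _ (by omega) ⟨s', hs', hu'.tail huw⟩

lemma IsLayering.exists_descent {A : V → V → Prop} {S : Set V} {ρ : V → ℕ}
    (hρ : IsLayering A S ρ) {n : ℕ} {w : V} (hw : ρ w = n) :
    ∃ x : ℕ → V, x n = w ∧ (∀ i ≤ n, ρ (x i) = i) ∧ ∀ i < n, A (x i) (x (i + 1)) := by
  induction n generalizing w with
  | zero => exact ⟨fun _ => w, rfl, by simpa using hw, by simp⟩
  | succ n ih =>
    obtain ⟨u, huw, hu⟩ := hρ.pred hw
    obtain ⟨y, hyn, hy, hy'⟩ := ih hu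
    refine ⟨fun i => if i ≤ n then y i else w, by simp, ?_, ?_⟩
    · intro i hi
      by_cases h : i ≤ n
      · simpa [h] using hy i h
      · obtain rfl : i = n + 1 := by omega
        simpa using hw
    · intro i hi
      rcases Nat.lt_or_ge i n with h | h
      · simpa [h.le, Nat.succ_le_of_lt h] using hy' i h
      · obtain rfl : i = n := by omega
        simpa [hyn] using huw

/-- `l` lists the vertices of a directed path from `u` to `v`. -/
structure IsPathList (A : V → V → Prop) (l : List V) (u v : V) : Prop where
  chain : l.IsChain A
  nodup : l.Nodup
  head : l.head? = some u
  last : l.getLast? = some v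

namespace IsPathList

variable {A : V → V → Prop}

lemma singleton (u : V) : IsPathList A [u] u u := ⟨by simp, by simp, rfl, rfl⟩

lemma append {l m : List V} {u v w z : V} (hl : IsPathList A l u v) (hm : IsPathList A m w z)
    (h : A v w) (hd : ∀ y ∈ l, y ∉ m) : IsPathList A (l ++ m) u z := by
  refine ⟨?_, ?_, ?_, ?_⟩
  · rw [List.isChain_append]
    refine ⟨hl.chain, hm.chain, ?_⟩
    rw [hl.last, hm.head]
    simpa using h
  · rw [List.nodup_append']
    exact ⟨hl.nodup, hm.nodup, fun _ h1 h2 => hd _ h1 h2⟩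
  · simp [hl.head]
  · simp [hm.last]

lemma cons {l : List V} {t u v : V} (hl : IsPathList A l u v) (h : A t u) (ht : t ∉ l) :
    IsPathList A (t :: l) t v :=
  (singleton t).append hl h (by simpa using ht)

lemma concat {l : List V} {u v w : V} (hl : IsPathList A l u v) (h : A v w) (hw : w ∉ l) :
    IsPathList A (l ++ [w]) u w :=
  hl.append (singleton w) h (fun _ hy hyw => hw (List.mem_singleton.1 hyw ▸ hy))

lemma adj {k : ℕ} (hqt : KQuasiTrans A k) {l : List V} {u v : V} (hl : IsPathList A l u v)
    (hk : l.length = k + 1) : A u v ∨ A v u := by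
  obtain ⟨hc, hn, hh, hla⟩ := hl
  refine hqt u v ⟨fun i => l[i.1]'(by omega), ?_, ?_, ?_, ?_⟩
  · intro i j hij
    exact Fin.ext ((List.Nodup.getElem_inj_iff hn).1 hij)
  · rw [List.head?_eq_getElem?, List.getElem?_eq_some_iff] at hh
    exact hh.2
  · rw [List.getLast?_eq_getElem?, List.getElem?_eq_some_iff] at hla
    obtain ⟨h1, h2⟩ := hla
    simpa [hk] using h2
  · intro i
    exact List.isChain_iff_getElem.1 hc i.1 (by omega)

end IsPathList

/-- `x 0, …, x (k + 2)` is a directed path all of whose arcs between non-consecutive vertices go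
backwards. -/
structure IsSpine (A : V → V → Prop) (k : ℕ) (x : ℕ → V) : Prop where
  inj : ∀ {i j}, i ≤ k + 2 → j ≤ k + 2 → x i = x j → i = j
  arc : ∀ {i}, i < k + 2 → A (x i) (x (i + 1))
  noskip : ∀ {i j}, i ≤ k + 2 → j ≤ k + 2 → A (x i) (x j) → j ≤ i + 1

/-- The vertices `x a, …, x b`. -/
def stretch (x : ℕ → V) (a b : ℕ) : List V := (List.range' a (b + 1 - a)).map x

lemma mem_stretch {x : ℕ → V} {a b : ℕ} {y : V} :
    y ∈ stretch x a b ↔ ∃ i, a ≤ i ∧ i ≤ b ∧ x i = y := by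
  simp only [stretch, List.mem_map, List.mem_range'_1]
  constructor
  · rintro ⟨i, hi, rfl⟩; exact ⟨i, by omega, by omega, rfl⟩
  · rintro ⟨i, h1, h2, rfl⟩; exact ⟨i, by omega, rfl⟩

lemma length_stretch (x : ℕ → V) (a b : ℕ) : (stretch x a b).length = b + 1 - a := by
  simp [stretch]

namespace IsSpine

variable {A : V → V → Prop} {k : ℕ} {x : ℕ → V}

lemma isPathList_stretch (hx : IsSpine A k x) {a b : ℕ} (hab : a ≤ b) (hb : b ≤ k + 2) :
    IsPathList A (stretch x a b) (x a) (x b) := by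
  induction b, hab using Nat.le_induction with
  | base => simpa [stretch] using IsPathList.singleton (x a)
  | succ b hab ih =>
    have : stretch x a (b + 1) = stretch x a b ++ [x (b + 1)] := by
      have e : b + 1 + 1 - a = (b + 1 - a) + 1 := by omega
      simp only [stretch, e, List.range'_concat, List.map_append, List.map_cons, List.map_nil]
      congr 3
      omega
    rw [this]
    refine (ih (by omega)).concat (hx.arc (by omega)) ?_
    rw [mem_stretch]
    rintro ⟨i, h1, h2, h3⟩
    have := hx.inj (by omega) hb h3
    omega

lemma notMem_stretch (hx : IsSpine A k x) {a b i : ℕ} (hb : b ≤ k + 2) (hi : i ≤ k + 2)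
    (h : i < a ∨ b < i) : x i ∉ stretch x a b := by
  rw [mem_stretch]
  rintro ⟨j, h1, h2, h3⟩
  have := hx.inj (by omega) hi h3
  omega

lemma stretch_disjoint (hx : IsSpine A k x) {a b c d : ℕ} (hb : b ≤ k + 2) (hd : d ≤ k + 2)
    (h : b < c ∨ d < a) : ∀ y ∈ stretch x a b, y ∉ stretch x c d := by
  intro y hy
  rw [mem_stretch] at hy
  obtain ⟨i, h1, h2, rfl⟩ := hy
  exact hx.notMem_stretch hd (by omega) (by omega)

lemma back_of_path (hx : IsSpine A k x) (hqt : KQuasiTrans A k) {l : List V} {i j : ℕ}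
    (hl : IsPathList A l (x j) (x i)) (hk : l.length = k + 1) (hj : j ≤ k + 2) (hij : i + 1 < j) :
    A (x j) (x i) := by
  refine (hl.adj hqt hk).resolve_right fun h => ?_
  have := hx.noskip (by omega) hj h
  omega

lemma back_of_path' (hx : IsSpine A k x) (hqt : KQuasiTrans A k) {l : List V} {i j : ℕ}
    (hl : IsPathList A l (x i) (x j)) (hk : l.length = k + 1) (hj : j ≤ k + 2) (hij : i + 1 < j) :
    A (x j) (x i) := by
  refine (hl.adj hqt hk).resolve_left fun h => ?_
  have := hx.noskip (by omega) hj h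
  omega

lemma back_k (hx : IsSpine A k x) (hqt : KQuasiTrans A k) (hk : 3 ≤ k) {i : ℕ} (hi : i ≤ 2) :
    A (x (i + k)) (x i) :=
  hx.back_of_path' hqt (hx.isPathList_stretch (by omega) (by omega))
    (by rw [length_stretch]; omega) (by omega) (by omega)

/-- Going round the cycle `x i, …, x (i + k)` from `x a` to `x (a - 2)` takes `k - 1` steps. -/
lemma isPathList_round (hx : IsSpine A k x) (hqt : KQuasiTrans A k) (hk : 3 ≤ k) {i a : ℕ}
    (hi : i ≤ 2) (hia : i ≤ a) (ha : a + 2 ≤ i + k) :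
    IsPathList A (stretch x (a + 2) (i + k) ++ stretch x i a) (x (a + 2)) (x a) :=
  (hx.isPathList_stretch (by omega) (by omega)).append (hx.isPathList_stretch hia (by omega))
    (hx.back_k hqt hk hi) (hx.stretch_disjoint (by omega) (by omega) (by omega))

lemma adj_down (hx : IsSpine A k x) (hqt : KQuasiTrans A k) (hk : 3 ≤ k) {i a : ℕ} {t : V}
    (hi : i ≤ 2) (hia : i ≤ a) (ha : a + 2 ≤ i + k) (ht : ∀ j, i ≤ j → j ≤ i + k → x j ≠ t)
    (h : A t (x (a + 2))) : A t (x a) ∨ A (x a) t := by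
  refine ((hx.isPathList_round hqt hk hi hia ha).cons h ?_).adj hqt ?_
  · simp only [List.mem_append, mem_stretch]
    rintro (⟨j, h1, h2, h3⟩ | ⟨j, h1, h2, h3⟩)
    · exact ht j (by omega) (by omega) h3
    · exact ht j (by omega) (by omega) h3
  · simp only [List.length_cons, List.length_append, length_stretch]
    omega

lemma adj_up (hx : IsSpine A k x) (hqt : KQuasiTrans A k) (hk : 3 ≤ k) {a : ℕ} {t : V}
    (ha : a ≤ 3) (ht : ∀ j, a ≤ j → j ≤ a + (k - 1) → x j ≠ t) (h : A t (x a)) :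
    A t (x (a + (k - 1))) ∨ A (x (a + (k - 1))) t := by
  refine ((hx.isPathList_stretch (a := a) (b := a + (k - 1)) (by omega) (by omega)).cons h
    ?_).adj hqt ?_
  · rw [mem_stretch]
    rintro ⟨j, h1, h2, h3⟩
    exact ht j h1 h2 h3
  · simp only [List.length_cons, length_stretch]
    omega

lemma last_back_zero (hx : IsSpine A k x) (hqt : KQuasiTrans A k) (hk : 3 ≤ k) :
    A (x (k + 2)) (x 0) := by
  have h2 := hx.back_k hqt hk le_rfl
  have h0 := hx.back_k hqt hk (i := 0) (by omega)
  rw [Nat.add_comm] at h2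
  simp only [Nat.zero_add] at h0
  have hp := (((hx.isPathList_stretch (a := 2) (b := k) (by omega) (by omega)).concat h0
    (hx.notMem_stretch (by omega) (by omega) (by omega))).cons (t := x (k + 2)) h2 (by
      rw [List.mem_append, List.mem_singleton, not_or]
      exact ⟨hx.notMem_stretch (by omega) (by omega) (by omega),
        fun h => by have := hx.inj le_rfl (by omega) h; omega⟩))
  refine hx.back_of_path hqt hp ?_ le_rfl (by omega)
  simp only [List.length_cons, List.length_append, length_stretch, List.length_nil]
  omega

lemma last_back_even (hx : IsSpine A k x) (hqt : KQuasiTrans A k) (hk : 3 ≤ k) (hko : Odd k)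
    {i : ℕ} (hi : i ≤ k - 1) (hie : Even i) : A (x (k + 2)) (x i) := by
  obtain ⟨q, rfl⟩ := hko
  have hne : ∀ j, j ≤ 2 * q + 1 + 1 → x j ≠ x (2 * q + 1 + 2) := fun j hj h => by
    have := hx.inj (by omega) le_rfl h
    omega
  have hforce : ∀ j, j ≤ 2 * q → A (x (2 * q + 1 + 2)) (x j) ∨ A (x j) (x (2 * q + 1 + 2)) →
      A (x (2 * q + 1 + 2)) (x j) := fun j hj h => h.resolve_right fun h => by
    have := hx.noskip (by omega) le_rfl h
    omega
  have hdown : ∀ m ≤ q, A (x (2 * q + 1 + 2)) (x (2 * (q - m))) := by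
    intro m
    induction m with
    | zero =>
      intro _
      have := hx.adj_up hqt hk (a := 0) (by omega) (fun j _ hj => hne j (by omega))
        (hx.last_back_zero hqt hk)
      simp only [Nat.zero_add, Nat.add_sub_cancel] at this
      exact hforce _ (by omega) this
    | succ m ih =>
      intro hm
      have := ih (by omega)
      have e : 2 * (q - m) = 2 * (q - (m + 1)) + 2 := by omega
      rw [e] at this
      exact hforce _ (by omega) (hx.adj_down hqt hk (i := 0) (by omega) (by omega) (by omega)
        (fun j _ hj => hne j (by omega)) this)
  obtain ⟨p, rfl⟩ := hie
  have := hdown (q - p) (by omega)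
  rwa [show 2 * (q - (q - p)) = p + p by omega] at this

lemma odd_back_zero (hx : IsSpine A k x) (hqt : KQuasiTrans A k) (hk : 3 ≤ k)
    {m : ℕ} (hm : 2 * m + 3 ≤ k) : A (x (2 * m + 3)) (x 0) := by
  induction m with
  | zero =>
    have hp := (hx.isPathList_stretch (a := 3) (b := k + 2) (by omega) le_rfl).concat
      (hx.last_back_zero hqt hk) (hx.notMem_stretch (by omega) (by omega) (by omega))
    refine hx.back_of_path hqt hp ?_ (by omega) (by omega)
    simp only [List.length_append, length_stretch, List.length_cons, List.length_nil]
    omega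
  | succ m ih =>
    have h := ih (by omega)
    have hp := (hx.isPathList_round hqt hk (i := 1) (a := 2 * m + 3) (by omega) (by omega)
      (by omega)).concat h (by
        rw [List.mem_append, not_or]
        exact ⟨hx.notMem_stretch (by omega) (by omega) (by omega),
          hx.notMem_stretch (by omega) (by omega) (by omega)⟩)
    refine hx.back_of_path hqt hp ?_ (by omega) (by omega)
    simp only [List.length_append, length_stretch, List.length_cons, List.length_nil]
    omega

lemma back_even_of_k (hx : IsSpine A k x) (hqt : KQuasiTrans A k) (hk : 3 ≤ k) (hko : Odd k)
    {i : ℕ} (hi : i + 3 ≤ k) (hie : Even i) : A (x k) (x i) := by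
  rcases Nat.lt_or_ge k (i + 5) with h | h
  · obtain ⟨q, rfl⟩ := hko
    obtain ⟨p, rfl⟩ := hie
    have hp := (hx.isPathList_stretch (a := 2 * q + 1) (b := 2 * q + 1 + 2) (by omega) le_rfl).append
      (hx.isPathList_stretch (a := 0) (b := p + p) (by omega) (by omega))
      (hx.last_back_zero hqt hk) (hx.stretch_disjoint (by omega) (by omega) (by omega))
    refine hx.back_of_path hqt hp ?_ (by omega) (by omega)
    simp only [List.length_append, length_stretch]
    omega
  · have h1 : A (x (k + 2)) (x (i + 2)) :=
      hx.last_back_even hqt hk hko (by omega) (by simpa [Nat.even_add_one, parity_simps] using hie)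
    have h2 : A (x (k - 2)) (x 0) := by
      obtain ⟨q, rfl⟩ := hko
      have := hx.odd_back_zero hqt hk (m := q - 2) (by omega)
      rwa [show 2 * (q - 2) + 3 = 2 * q + 1 - 2 by omega] at this
    have hp := ((hx.isPathList_stretch (a := k) (b := k + 2) (by omega) le_rfl).append
      (hx.isPathList_stretch (a := i + 2) (b := k - 2) (by omega) (by omega)) h1
      (hx.stretch_disjoint (by omega) (by omega) (by omega))).append
      (hx.isPathList_stretch (a := 0) (b := i) (by omega) (by omega)) h2 (by
        intro y hy
        rcases List.mem_append.1 hy with hy | hy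
        · exact hx.stretch_disjoint (by omega) (by omega) (by omega) y hy
        · exact hx.stretch_disjoint (by omega) (by omega) (by omega) y hy)
    refine hx.back_of_path hqt hp ?_ (by omega) (by omega)
    simp only [List.length_append, length_stretch]
    omega

/-- The last four vertices of a spine are within distance three of the whole spine. -/
lemma walkLe_three (hx : IsSpine A k x) (hqt : KQuasiTrans A k) (hk : 3 ≤ k) (hko : Odd k)
    {j i : ℕ} (hj : k ≤ j + 1) (hj' : j ≤ k + 2) (hi : i ≤ k + 2) : WalkLe A 3 (x j) (x i) := by
  have hlast : ∀ {i}, i ≤ k - 1 → Even i → A (x (k + 2)) (x i) :=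
    fun h h' => hx.last_back_even hqt hk hko h h'
  have hback : ∀ {i}, i + 3 ≤ k → Even i → A (x k) (x i) :=
    fun h h' => hx.back_even_of_k hqt hk hko h h'
  have e1 : A (x k) (x (k + 1)) := hx.arc (by omega)
  have e2 : A (x (k + 1)) (x (k + 2)) := hx.arc (by omega)
  have e0 : A (x (k - 1)) (x k) := by
    have := hx.arc (i := k - 1) (by omega)
    rwa [show k - 1 + 1 = k by omega] at this
  have hk1 : Even (k - 1) := Nat.Odd.sub_odd hko odd_one
  have hcases : i = k + 2 ∨ i = k + 1 ∨ i = k ∨ i = k - 1 ∨ (i + 3 ≤ k ∧ Even i) ∨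
      ∃ p, i = p + 1 ∧ p + 3 ≤ k ∧ Even p := by
    rcases Nat.even_or_odd' i with ⟨m, rfl | rfl⟩
    · obtain ⟨q, rfl⟩ := hko
      have : Even (2 * m) := even_two_mul m
      rcases Nat.lt_or_ge m q with h | h
      · exact .inr (.inr (.inr (.inr (.inl ⟨by omega, this⟩))))
      · omega
    · obtain ⟨q, rfl⟩ := hko
      rcases Nat.lt_or_ge m q with h | h
      · exact .inr (.inr (.inr (.inr (.inr ⟨2 * m, rfl, by omega, even_two_mul m⟩))))
      · omega
  have l1 := hlast le_rfl hk1
  obtain rfl | rfl | rfl | rfl : j = k + 2 ∨ j = k + 1 ∨ j = k ∨ j = k - 1 := by omega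
  · rcases hcases with rfl | rfl | rfl | rfl | ⟨h, h'⟩ | ⟨p, rfl, h, h'⟩
    · exact .refl _ _
    · exact .head l1 (.head e0 (.single e1))
    · exact (WalkLe.head l1 (.single e0)).mono (by omega)
    · exact (WalkLe.single l1).mono (by omega)
    · exact (WalkLe.single (hlast (by omega) h')).mono (by omega)
    · exact (WalkLe.head (hlast (by omega) h') (.single (hx.arc (by omega)))).mono (by omega)
  · rcases hcases with rfl | rfl | rfl | rfl | ⟨h, h'⟩ | ⟨p, rfl, h, h'⟩
    · exact (WalkLe.single e2).mono (by omega)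
    · exact .refl _ _
    · exact .head e2 (.head l1 (.single e0))
    · exact (WalkLe.head e2 (.single l1)).mono (by omega)
    · exact (WalkLe.head e2 (.single (hlast (by omega) h'))).mono (by omega)
    · exact .head e2 (.head (hlast (by omega) h') (.single (hx.arc (by omega))))
  · rcases hcases with rfl | rfl | h | rfl | ⟨h, h'⟩ | ⟨p, rfl, h, h'⟩
    · exact (WalkLe.head e1 (.single e2)).mono (by omega)
    · exact (WalkLe.single e1).mono (by omega)
    · exact h ▸ .refl _ _
    · exact .head e1 (.head e2 (.single l1))
    · exact (WalkLe.single (hback h h')).mono (by omega)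
    · exact (WalkLe.head (hback h h') (.single (hx.arc (by omega)))).mono (by omega)
  · rcases hcases with rfl | rfl | rfl | rfl | ⟨h, h'⟩ | ⟨p, rfl, h, h'⟩
    · exact .head e0 (.head e1 (.single e2))
    · exact (WalkLe.head e0 (.single e1)).mono (by omega)
    · exact (WalkLe.single e0).mono (by omega)
    · exact .refl _ _
    · exact (WalkLe.head e0 (.single (hback h h'))).mono (by omega)
    · exact .head e0 (.head (hback h h') (.single (hx.arc (by omega))))

end IsSpine

/-- A `k`-quasi-transitive digraph with a spine reaching every vertex, together with the distance
`ρ` from the spine. -/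
structure IsSpineLayering (A : V → V → Prop) (k : ℕ) (x : ℕ → V) (ρ : V → ℕ) : Prop where
  qt : KQuasiTrans A k
  three_le : 3 ≤ k
  odd : Odd k
  spine : IsSpine A k x
  layering : IsLayering A {w | ∃ i ≤ k + 2, x i = w} ρ

/-- `w` is at distance `j` from the spine, and some shortest path from the spine to `w` starts
at a vertex `x b` with `b + j` congruent to `c` modulo two. -/
def ParityAt (A : V → V → Prop) (k : ℕ) (x : ℕ → V) (ρ : V → ℕ) : ℕ → ℕ → V → Prop
  | c, 0, w => ∃ b ≤ k + 2, b % 2 = c % 2 ∧ x b = w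
  | c, j + 1, w => ρ w = j + 1 ∧ ∃ u, A u w ∧ ParityAt A k x ρ (c + 1) j u

lemma ParityAt.congr {A : V → V → Prop} {k : ℕ} {x : ℕ → V} {ρ : V → ℕ} {c c' j : ℕ} {w : V}
    (h : ParityAt A k x ρ c j w) (hc : c % 2 = c' % 2) : ParityAt A k x ρ c' j w := by
  induction j generalizing c c' w with
  | zero => obtain ⟨b, hb, hbc, rfl⟩ := h; exact ⟨b, hb, hbc.trans hc, rfl⟩
  | succ j ih =>
    obtain ⟨hw, u, huw, hu⟩ := h
    exact ⟨hw, u, huw, ih hu (by omega)⟩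

namespace IsSpineLayering

variable {A : V → V → Prop} {k : ℕ} {x : ℕ → V} {ρ : V → ℕ} {c j r : ℕ} {t w : V}

lemma layer_spine (h : IsSpineLayering A k x ρ) {i : ℕ} (hi : i ≤ k + 2) : ρ (x i) = 0 :=
  (h.layering.zero_iff _).2 ⟨i, hi, rfl⟩

lemma layer_eq (h : IsSpineLayering A k x ρ) (hw : ParityAt A k x ρ c j w) : ρ w = j := by
  cases j with
  | zero => obtain ⟨b, hb, -, rfl⟩ := hw; exact h.layer_spine hb
  | succ j => exact hw.1

lemma exists_parity (h : IsSpineLayering A k x ρ) (c : ℕ) (hw : ρ w = j) :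
    ParityAt A k x ρ c j w ∨ ParityAt A k x ρ (c + 1) j w := by
  induction j generalizing w with
  | zero =>
    obtain ⟨b, hb, rfl⟩ := (h.layering.zero_iff w).1 hw
    rcases Nat.mod_two_eq_zero_or_one (b + c) with h | h
    · exact .inl ⟨b, hb, by omega, rfl⟩
    · exact .inr ⟨b, hb, by omega, rfl⟩
  | succ j ih =>
    obtain ⟨u, huw, hu⟩ := h.layering.pred hw
    rcases ih hu with hu | hu
    · exact .inr ⟨hw, u, huw, hu.congr (by omega)⟩
    · exact .inl ⟨hw, u, huw, hu⟩

lemma exists_pred (h : IsSpineLayering A k x ρ) (hw : ParityAt A k x ρ c j w) :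
    ∃ u, A u w ∧ ParityAt A k x ρ (c + 1) (j - 1) u := by
  cases j with
  | zero =>
    obtain ⟨b, hb, hbc, rfl⟩ := hw
    cases b with
    | zero =>
      have := h.spine.back_k h.qt h.three_le (i := 0) (by omega)
      rw [Nat.zero_add] at this
      obtain ⟨q, hq⟩ := h.odd
      exact ⟨x k, this, k, by omega, by omega, rfl⟩
    | succ b => exact ⟨x b, h.spine.arc (by omega), b, by omega, by omega, rfl⟩
  | succ j => exact hw.2

/-- Shortest paths from the spine, prolonged backwards along the spine. -/
lemma exists_isPathList (h : IsSpineLayering A k x ρ) {n : ℕ} (hn : n ≤ k)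
    (hw : ParityAt A k x ρ c j w) :
    ∃ l s, IsPathList A l s w ∧ l.length = n + 1 ∧ (∀ y ∈ l, ρ y ≤ j ∧ j - n ≤ ρ y) ∧
      ParityAt A k x ρ (c + n) (j - n) s := by
  induction j generalizing c n w with
  | zero =>
    obtain ⟨b, hb, hbc, rfl⟩ := hw
    rcases Nat.lt_or_ge b n with hbn | hbn
    · have h0 := h.spine.back_k h.qt h.three_le (i := 0) (by omega)
      rw [Nat.zero_add] at h0
      obtain ⟨q, hq⟩ := h.odd
      refine ⟨_, _, (h.spine.isPathList_stretch (a := b + k + 1 - n) (b := k) (by omega)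
        (by omega)).append (h.spine.isPathList_stretch (a := 0) (b := b) (by omega) hb) h0
        (h.spine.stretch_disjoint (by omega) hb (by omega)), ?_, ?_, ?_⟩
      · simp only [List.length_append, length_stretch]
        omega
      · intro y hy
        rw [List.mem_append, mem_stretch, mem_stretch] at hy
        rcases hy with ⟨i, -, hi, rfl⟩ | ⟨i, -, hi, rfl⟩ <;> simp [h.layer_spine (show i ≤ k + 2 by omega)]
      · rw [Nat.zero_sub]
        exact ⟨_, by omega, by omega, rfl⟩
    · refine ⟨_, _, h.spine.isPathList_stretch (a := b - n) (b := b) (by omega) hb, ?_, ?_, ?_⟩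
      · rw [length_stretch]
        omega
      · intro y hy
        obtain ⟨i, -, hi, rfl⟩ := mem_stretch.1 hy
        simp [h.layer_spine (hi.trans hb)]
      · rw [Nat.zero_sub]
        exact ⟨_, by omega, by omega, rfl⟩
  | succ j ih =>
    cases n with
    | zero => exact ⟨[w], w, .singleton w, rfl, by simp [h.layer_eq hw], hw⟩
    | succ n =>
      obtain ⟨u, huw, hu⟩ := hw.2
      obtain ⟨l, s, hl, hlen, hρ, hs⟩ := ih (n := n) (by omega) hu
      have hwj := h.layer_eq hw
      refine ⟨_, s, hl.concat huw fun hwl => ?_, by simp [hlen], ?_, ?_⟩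
      · have := (hρ w hwl).1
        omega
      · intro y hy
        rcases List.mem_append.1 hy with hy | hy
        · have := hρ y hy
          omega
        · rw [List.mem_singleton.1 hy]
          omega
      · rw [Nat.add_sub_add_right]
        exact hs.congr (by omega)

lemma not_adj_spine (h : IsSpineLayering A k x ρ) (ht : 2 ≤ ρ t) {i : ℕ} (hi : i ≤ k + 2) :
    ¬ A (x i) t := fun hA => by
  have := h.layering.step hA
  rw [h.layer_spine hi] at this
  omega

/-- A vertex at distance at least two from the spine dominates a whole parity class of the spine
as soon as it dominates one vertex of it. -/
lemma dominates_of_adj (h : IsSpineLayering A k x ρ) (ht : 2 ≤ ρ t) {a : ℕ} (ha : a ≤ k + 2)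
    (hta : A t (x a)) {i : ℕ} (hi : i ≤ k + 2) (hia : i % 2 = a % 2) : A t (x i) := by
  have hk := h.three_le
  obtain ⟨q, hq⟩ := h.odd
  have hne : ∀ j ≤ k + 2, x j ≠ t := fun j hj e => by
    rw [← e, h.layer_spine hj] at ht
    omega
  have down : ∀ m b, b + 2 * m ≤ k + 2 → A t (x (b + 2 * m)) → A t (x b) := by
    intro m
    induction m with
    | zero => intro b _ hb; exact hb
    | succ m ih =>
      intro b hb hA
      have e : b + 2 * (m + 1) = b + 2 * m + 2 := by omega
      rw [e] at hA
      refine ih b (by omega) ((h.spine.adj_down h.qt hk (i := b + 2 * m + 2 - k) (by omega)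
        (by omega) (by omega) (fun j _ hj => hne j (by omega)) hA).resolve_right
        (h.not_adj_spine ht (by omega)))
  have up : ∀ b ≤ 3, A t (x b) → A t (x (b + (k - 1))) := fun b hb hA =>
    (h.spine.adj_up h.qt hk hb (fun j _ hj => hne j (by omega)) hA).resolve_right
      (h.not_adj_spine ht (by omega))
  have down' : ∀ b d, b ≤ d → b % 2 = d % 2 → d ≤ k + 2 → A t (x d) → A t (x b) := by
    intro b d hbd hp hd hA
    obtain ⟨m, rfl⟩ : ∃ m, d = b + 2 * m := ⟨(d - b) / 2, by omega⟩
    exact down m b hd hA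
  have h1 := up (a % 2) (by omega) (down' (a % 2) a (by omega) (by omega) ha hta)
  have h2 := up (a % 2 + 2) (by omega)
    (down' (a % 2 + 2) _ (by omega) (by omega) (by omega) h1)
  exact down' i _ (by omega) (by omega) (by omega) h2

lemma dominates (h : IsSpineLayering A k x ρ) (hj : 2 ≤ j) (ht : ParityAt A k x ρ c j t) {i : ℕ}
    (hi : i ≤ k + 2) (hic : i % 2 = (c + 1) % 2) : A t (x i) := by
  induction j using Nat.strong_induction_on generalizing c t i with
  | _ j ih =>
    have hk := h.three_le
    obtain ⟨q, hq⟩ := h.odd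
    have htj := h.layer_eq ht
    rcases Nat.lt_or_ge k j with hkj | hkj
    · obtain ⟨l, s, hl, hlen, hρ, hs⟩ := h.exists_isPathList (n := k - 1) (by omega) ht
      have hsρ := h.layer_eq hs
      obtain ⟨u, hus, hu⟩ := h.exists_pred hs
      have huρ := h.layer_eq hu
      have htu : A t u := by
        refine ((hl.cons hus fun hul => ?_).adj h.qt (by simp [hlen]; omega)).resolve_left ?_
        · have := hρ u hul
          omega
        · intro hA
          have := h.layering.step hA
          omega
      have hse : A s (x ((c + 1) % 2)) :=
        ih _ (by omega) (by omega) hs (by omega) (by omega)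
      have hout : ∀ y, 0 < ρ y → y ∉ stretch x ((c + 1) % 2) ((c + 1) % 2 + (k - 3)) := by
        intro y hy hyl
        obtain ⟨m, -, hm, rfl⟩ := mem_stretch.1 hyl
        rw [h.layer_spine (by omega)] at hy
        omega
      have hp := (((h.spine.isPathList_stretch (a := (c + 1) % 2) (b := (c + 1) % 2 + (k - 3))
        (by omega) (by omega)).cons hse (hout s (by omega))).cons hus (by
          rw [List.mem_cons, not_or]
          exact ⟨fun e => by rw [e] at huρ; omega, hout u (by omega)⟩)).cons htu (by
          rw [List.mem_cons, List.mem_cons, not_or, not_or]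
          exact ⟨fun e => by rw [e] at htj; omega, fun e => by rw [e] at htj; omega,
            hout t (by omega)⟩)
      have := (hp.adj h.qt (by
        simp only [List.length_cons, length_stretch]; omega)).resolve_right
        (h.not_adj_spine (by omega) (by omega))
      exact h.dominates_of_adj (by omega) (by omega) this hi (by omega)
    · obtain ⟨l, s, hl, hlen, hρ, hs⟩ := h.exists_isPathList (n := k) le_rfl ht
      rw [Nat.sub_eq_zero_of_le hkj] at hs
      obtain ⟨b, hb, hbc, rfl⟩ := hs
      exact h.dominates_of_adj (by omega) hb
        ((hl.adj h.qt hlen).resolve_left (h.not_adj_spine (by omega) hb)) hi (by omega)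

lemma adj_of_lt (h : IsSpineLayering A k x ρ) (hr : 2 ≤ r) (ht : ParityAt A k x ρ c r t)
    (hjr : j < r) (hw : ParityAt A k x ρ (c + 1) j w) : A t w ∨ A w t := by
  induction j using Nat.strong_induction_on generalizing w with
  | _ j ih =>
    have hk := h.three_le
    obtain ⟨q, hq⟩ := h.odd
    have htr := h.layer_eq ht
    obtain ⟨l, s, hl, hlen, hρ, hs⟩ := h.exists_isPathList (n := k - 1) (by omega) hw
    have hts : A t s := by
      rcases Nat.lt_or_ge (k - 1) j with hkj | hkj
      · refine (ih _ (by omega) (by omega) (hs.congr (by omega))).resolve_right fun hA => ?_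
        have := h.layering.step hA
        have := h.layer_eq hs
        omega
      · rw [Nat.sub_eq_zero_of_le hkj] at hs
        obtain ⟨b, hb, hbc, rfl⟩ := hs
        exact h.dominates hr ht hb (by omega)
    refine (hl.cons hts fun htl => ?_).adj h.qt (by simp [hlen]; omega)
    have := (hρ t htl).1
    omega

lemma adj_of_add_two_le (h : IsSpineLayering A k x ρ) (hr : 2 ≤ r)
    (ht : ParityAt A k x ρ c r t) (hjr : j + 2 ≤ r) (hw : ParityAt A k x ρ (c + 1) j w) :
    A t w := by
  refine (h.adj_of_lt hr ht (by omega) hw).resolve_right fun hA => ?_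
  have := h.layering.step hA
  rw [h.layer_eq ht, h.layer_eq hw] at this
  omega

lemma walkLe_two (h : IsSpineLayering A k x ρ) (hr : 2 ≤ r) (ht : ParityAt A k x ρ c r t)
    (hjr : j < r) (hw : ParityAt A k x ρ c j w) : WalkLe A 2 t w := by
  obtain ⟨u, huw, hu⟩ := h.exists_pred hw
  exact .head (h.adj_of_add_two_le hr ht (by omega) hu) (.single huw)

lemma walkLe_three (h : IsSpineLayering A k x ρ) (hr : 2 ≤ r) (ht : ParityAt A k x ρ c r t)
    (hjr : j ≤ r) (hw : ParityAt A k x ρ (c + 1) j w) : WalkLe A 3 t w := by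
  obtain ⟨u, huw, hu⟩ := h.exists_pred hw
  exact (h.walkLe_two hr ht (by omega) (hu.congr (by omega))).tail huw

lemma walkLe_four (h : IsSpineLayering A k x ρ) (hr : 2 ≤ r) (ht : ParityAt A k x ρ c r t)
    (hjr : j ≤ r) (hw : ParityAt A k x ρ c j w) : WalkLe A 4 t w := by
  obtain ⟨u, huw, hu⟩ := h.exists_pred hw
  exact (h.walkLe_three hr ht (by omega) hu).tail huw

lemma isRKing_four (h : IsSpineLayering A k x ρ) (hr : 2 ≤ r) (hmax : ∀ w, ρ w ≤ r)
    (ht : ParityAt A k x ρ c r t) : IsRKing A 4 t := by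
  rw [isRKing_iff_walkLe]
  intro w
  rcases h.exists_parity c (rfl : ρ w = ρ w) with hw | hw
  · exact h.walkLe_four hr ht (hmax w) hw
  · exact (h.walkLe_three hr ht (hmax w) hw).mono (by omega)

lemma mem_of_closed (h : IsSpineLayering A k x ρ) {C : Set V}
    (hC : ∀ u v, A u v → v ∈ C → u ∈ C) (h0 : x 0 ∈ C) (hr : 2 ≤ r)
    (ht : ParityAt A k x ρ c r t) : t ∈ C := by
  have hk := h.three_le
  have hkC : x k ∈ C := by
    have := h.spine.back_k h.qt hk (i := 0) (by omega)
    rw [Nat.zero_add] at this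
    exact hC _ _ this h0
  have hC' : ∀ m ≤ k, x (k - m) ∈ C := by
    intro m
    induction m with
    | zero => intro _; exact hkC
    | succ m ih =>
      intro hm
      have := h.spine.arc (i := k - (m + 1)) (by omega)
      rw [show k - (m + 1) + 1 = k - m by omega] at this
      exact hC _ _ this (ih (by omega))
  have := hC' (k - (c + 1) % 2) (by omega)
  rw [show k - (k - (c + 1) % 2) = (c + 1) % 2 by omega] at this
  exact hC _ _ (h.dominates hr ht (by omega) (by omega)) this

/-- A vertex of the last layer which is not a `3`-king has a companion of the same parity only. -/
lemma exists_companion (h : IsSpineLayering A k x ρ) (hr : 2 ≤ r) (hmax : ∀ w, ρ w ≤ r)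
    (ht : ParityAt A k x ρ c r t) (hno : ¬ IsRKing A 3 t) :
    ∃ t', t' ≠ t ∧ ParityAt A k x ρ c r t' ∧ ¬ ParityAt A k x ρ (c + 1) r t' := by
  rw [isRKing_iff_walkLe] at hno
  push Not at hno
  obtain ⟨w, hw⟩ := hno
  have hw1 : ¬ ParityAt A k x ρ (c + 1) (ρ w) w := fun h1 => hw (h.walkLe_three hr ht (hmax w) h1)
  have hw0 := (h.exists_parity c (rfl : ρ w = ρ w)).resolve_right hw1
  have hwr : ρ w = r := (hmax w).eq_of_not_lt fun hlt =>
    hw ((h.walkLe_two hr ht hlt hw0).mono (by omega))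
  rw [hwr] at hw0 hw1
  exact ⟨w, fun e => hw (e ▸ .refl _ _), hw0, hw1⟩

lemma exists_pair (h : IsSpineLayering A k x ρ) (hr : 2 ≤ r) (hmax : ∀ w, ρ w ≤ r)
    (hno : ∀ c t, ParityAt A k x ρ c r t → ¬ IsRKing A 3 t) (ht : ParityAt A k x ρ c r t) :
    ∃ t₁ t₂, t₁ ≠ t₂ ∧ (ParityAt A k x ρ c r t₁ ∧ ¬ ParityAt A k x ρ (c + 1) r t₁) ∧
      (ParityAt A k x ρ c r t₂ ∧ ¬ ParityAt A k x ρ (c + 1) r t₂) := by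
  obtain ⟨t₁, -, h₁, h₁'⟩ := h.exists_companion hr hmax ht (hno _ _ ht)
  obtain ⟨t₂, hne, h₂, h₂'⟩ := h.exists_companion hr hmax h₁ (hno _ _ h₁)
  exact ⟨t₁, t₂, hne.symm, ⟨h₁, h₁'⟩, ⟨h₂, h₂'⟩⟩

/-- If the last layer has one parity only, then the vertices of the previous layer with most
out-neighbours in the last layer are `4`-kings, and there are at least two of them unless there
is a `3`-king. -/
lemma exists_pair_of_single_parity [Finite V] (h : IsSpineLayering A k x ρ) (hr : 2 ≤ r)
    (hmax : ∀ w, ρ w ≤ r) (ht : ParityAt A k x ρ c r t)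
    (hsingle : ∀ y, ¬ ParityAt A k x ρ (c + 1) r y)
    (hno : ∀ w y, A w y → ParityAt A k x ρ c r y → ¬ IsRKing A 3 w) :
    ∃ w₁ w₂, w₁ ≠ w₂ ∧ ρ w₁ < r ∧ ρ w₂ < r ∧ IsRKing A 4 w₁ ∧ IsRKing A 4 w₂ := by
  let W : Set V := {w | ParityAt A k x ρ (c + 1) (r - 1) w}
  let N : V → Set V := fun w => {y | A w y ∧ ParityAt A k x ρ c r y}
  obtain ⟨u, hut, hu⟩ := h.exists_pred ht
  obtain ⟨w, hw, hwmax⟩ := Set.exists_max_image W (fun w => (N w).ncard) (Set.toFinite _) ⟨u, hu⟩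
  have key : ∀ w ∈ W, (∀ v ∈ W, (N v).ncard ≤ (N w).ncard) →
      (∃ y, A w y ∧ ParityAt A k x ρ c r y) ∧
      (∀ w' ∈ W, ¬ WalkLe A 2 w w' → N w = N w') ∧ IsRKing A 4 w ∧
      (∀ z, z ∉ W → WalkLe A 3 w z) := by
    intro w hw hwmax
    have hN : (N w).Nonempty := by
      have h1 : 0 < (N u).ncard := (Set.ncard_pos (Set.toFinite _)).2 ⟨t, hut, ht⟩
      exact (Set.ncard_pos (Set.toFinite _)).1 (h1.trans_le (hwmax u hu))
    obtain ⟨y, hwy, hy⟩ := hN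
    have heq : ∀ w' ∈ W, ¬ WalkLe A 2 w w' → N w = N w' := by
      intro w' hw' hwalk
      refine Set.eq_of_subset_of_ncard_le ?_ (hwmax w' hw') (Set.toFinite _)
      rintro z ⟨hwz, hz⟩
      refine ⟨(h.adj_of_lt hr hz (by omega) hw').resolve_left fun hA => ?_, hz⟩
      exact hwalk (.head hwz (.single hA))
    have hthree : ∀ z, z ∉ W → WalkLe A 3 w z := by
      intro z hzW
      rcases (hmax z).eq_or_lt with hzr | hzr
      · have hz := (h.exists_parity c hzr).resolve_right (hsingle z)
        obtain ⟨w', hw'z, hw'⟩ := h.exists_pred hz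
        by_cases hwalk : WalkLe A 2 w w'
        · exact hwalk.tail hw'z
        · have hmem : z ∈ N w' := ⟨hw'z, hz⟩
          rw [← heq w' hw' hwalk] at hmem
          exact (WalkLe.single hmem.1).mono (by omega)
      · rcases h.exists_parity c (rfl : ρ z = ρ z) with hz | hz
        · exact .head hwy (h.walkLe_two hr hy hzr hz)
        · have hlt : ρ z ≠ r - 1 := fun e => hzW (by rw [e] at hz; exact hz)
          exact (WalkLe.head hwy (.single (h.adj_of_add_two_le hr hy (by omega) hz))).mono (by omega)
    refine ⟨⟨y, hwy, hy⟩, heq, ?_, hthree⟩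
    rw [isRKing_iff_walkLe]
    intro z
    by_cases hz : z ∈ W
    · exact .head hwy (h.walkLe_three hr hy (by omega) hz)
    · exact (hthree z hz).mono (by omega)
  obtain ⟨⟨y, hwy, hy⟩, heq, hking, hthree⟩ := key w hw hwmax
  have hno3 := hno w y hwy hy
  rw [isRKing_iff_walkLe] at hno3
  push Not at hno3
  obtain ⟨z, hz⟩ := hno3
  have hzW : z ∈ W := by
    by_contra hzW
    exact hz (hthree z hzW)
  have hNz := heq z hzW fun hwalk => hz (hwalk.mono (by omega))
  have hzking := (key z hzW fun v hv => hNz ▸ hwmax v hv).2.2.1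
  have h1 := h.layer_eq hw
  have h2 := h.layer_eq hzW
  exact ⟨w, z, fun e => hz (e ▸ .refl _ _), by omega, by omega, hking, hzking⟩

end IsSpineLayering

lemma four_le_ncard [Finite V] {S : Set V} {a b c d : V} (ha : a ∈ S) (hb : b ∈ S) (hc : c ∈ S)
    (hd : d ∈ S) (hab : a ≠ b) (hac : a ≠ c) (had : a ≠ d) (hbc : b ≠ c) (hbd : b ≠ d)
    (hcd : c ≠ d) : 4 ≤ S.ncard := by
  classical
  have hsub : (({a, b, c, d} : Finset V) : Set V) ⊆ S := by
    intro y hy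
    simp only [Finset.coe_insert, Finset.coe_singleton, Set.mem_insert_iff,
      Set.mem_singleton_iff] at hy
    rcases hy with rfl | rfl | rfl | rfl <;> assumption
  have hcard : ({a, b, c, d} : Finset V).card = 4 := by
    simp [hab, hac, had, hbc, hbd, hcd]
  have := Set.ncard_le_ncard hsub (Set.toFinite S)
  rwa [Set.ncard_coe_finset, hcard] at this

lemma IsSpineLayering.four_le_ncard_kings [Finite V] {A : V → V → Prop} {k : ℕ} {x : ℕ → V}
    {ρ : V → ℕ} (h : IsSpineLayering A k x ρ) {C : Set V} (hC : ∀ u v, A u v → v ∈ C → u ∈ C)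
    (h0 : x 0 ∈ C) (hno : ∀ v ∈ C, ¬ IsRKing A 3 v) : 4 ≤ {v : V | IsRKing A 4 v}.ncard := by
  haveI : Nonempty V := ⟨x 0⟩
  obtain ⟨t, hmax⟩ := Finite.exists_max ρ
  rcases Nat.lt_or_ge (ρ t) 2 with hr | hr
  · have hk := h.three_le
    have hking : ∀ j, k ≤ j + 1 → j ≤ k + 2 → IsRKing A 4 (x j) := by
      intro j hj hj'
      rw [isRKing_iff_walkLe]
      intro w
      have hwalk : ∀ i ≤ k + 2, WalkLe A 3 (x j) (x i) := fun i hi =>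
        h.spine.walkLe_three h.qt hk h.odd hj hj' hi
      rcases Nat.eq_zero_or_pos (ρ w) with hw | hw
      · obtain ⟨i, hi, rfl⟩ := (h.layering.zero_iff w).1 hw
        exact (hwalk i hi).mono (by omega)
      · obtain ⟨u, huw, hu⟩ := h.layering.pred (w := w) (j := 0) (by have := hmax w; omega)
        obtain ⟨i, hi, rfl⟩ := (h.layering.zero_iff u).1 hu
        exact (hwalk i hi).tail huw
    have hne : ∀ i j, i ≤ k + 2 → j ≤ k + 2 → i ≠ j → x i ≠ x j :=
      fun i j hi hj hij e => hij (h.spine.inj hi hj e)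
    exact four_le_ncard (hking (k - 1) (by omega) (by omega)) (hking k (by omega) (by omega))
      (hking (k + 1) (by omega) (by omega)) (hking (k + 2) (by omega) (by omega))
      (hne _ _ (by omega) (by omega) (by omega)) (hne _ _ (by omega) (by omega) (by omega))
      (hne _ _ (by omega) (by omega) (by omega)) (hne _ _ (by omega) (by omega) (by omega))
      (hne _ _ (by omega) (by omega) (by omega)) (hne _ _ (by omega) (by omega) (by omega))
  · obtain ⟨c, ht⟩ : ∃ c, ParityAt A k x ρ c (ρ t) t :=
      (h.exists_parity 0 rfl).elim (fun h => ⟨_, h⟩) (fun h => ⟨_, h⟩)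
    have hno' : ∀ c t', ParityAt A k x ρ c (ρ t) t' → ¬ IsRKing A 3 t' := fun c t' ht' =>
      hno t' (h.mem_of_closed hC h0 hr ht')
    obtain ⟨t₁, t₂, hne, ⟨h₁, h₁'⟩, h₂, h₂'⟩ := h.exists_pair hr hmax hno' ht
    by_cases hother : ∃ s, ParityAt A k x ρ (c + 1) (ρ t) s
    · obtain ⟨s, hs⟩ := hother
      obtain ⟨s₁, s₂, hne', ⟨h₃, -⟩, h₄, -⟩ := h.exists_pair hr hmax hno' hs
      exact four_le_ncard (h.isRKing_four hr hmax h₁) (h.isRKing_four hr hmax h₂)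
        (h.isRKing_four hr hmax h₃) (h.isRKing_four hr hmax h₄) hne
        (fun e => h₁' (e ▸ h₃)) (fun e => h₁' (e ▸ h₄)) (fun e => h₂' (e ▸ h₃))
        (fun e => h₂' (e ▸ h₄)) hne'
    · push Not at hother
      obtain ⟨w₁, w₂, hne', h₃, h₄, hk₃, hk₄⟩ := h.exists_pair_of_single_parity hr hmax ht hother
        (fun w y hwy hy => hno w (hC w y hwy (h.mem_of_closed hC h0 hr hy)))
      have e₁ := h.layer_eq h₁
      have e₂ := h.layer_eq h₂
      exact four_le_ncard (h.isRKing_four hr hmax h₁) (h.isRKing_four hr hmax h₂) hk₃ hk₄ hne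
        (fun e => by rw [e] at e₁; omega) (fun e => by rw [e] at e₁; omega)
        (fun e => by rw [e] at e₂; omega) (fun e => by rw [e] at e₂; omega) hne'

/-- odd `k ≥ 3`, unique initial strong component `C`; either every vertex
of `C` is a `(k+1)`-king, or whenever no vertex of `C` is a `3`-king there are at least
four `4`-kings. -/
theorem kqt_odd_main
    [Fintype V] (A : V → V → Prop) (hloop : ∀ v : V, ¬ A v v)
    (k : ℕ) (hk : 3 ≤ k) (hko : Odd k) (hqt : KQuasiTrans A k)
    (C : Set V) (hC : IsInitialStrongComponent A C)
    (huniq : ∀ S : Set V, IsInitialStrongComponent A S → S = C) :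
    (∀ v ∈ C, IsRKing A (k + 1) v) ∨
      ((∀ v ∈ C, ¬ IsRKing A 3 v) → 4 ≤ {v : V | IsRKing A 4 v}.ncard) := by
  by_contra hcon
  push Not at hcon
  obtain ⟨⟨v, hvC, hv⟩, hno, hlt⟩ := hcon
  have hclosed : ∀ a b, A a b → b ∈ C → a ∈ C := fun a b hab hb =>
    by_contra fun ha => hC.2 a b ha hb hab
  have hreach : ∀ w, Relation.ReflTransGen A v w := by
    intro w
    obtain ⟨S, hS, s, hs, hSw⟩ := exists_initial_reaching A w
    rw [huniq S hS] at hSw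
    exact hSw v hvC
  obtain ⟨δ, hδ⟩ := exists_isLayering A {v} fun w => ⟨v, rfl, hreach w⟩
  have hwalk : ∀ n w, δ w = n → WalkLe A n v w := by
    intro n
    induction n with
    | zero => intro w hw; exact ((hδ.zero_iff w).1 hw : w = v).symm
    | succ n ih =>
      intro w hw
      obtain ⟨u, huw, hu⟩ := hδ.pred hw
      exact (ih u hu).tail huw
  rw [isRKing_iff_walkLe] at hv
  push Not at hv
  obtain ⟨w, hw⟩ := hv
  have hwk : k + 2 ≤ δ w := by
    by_contra hlt
    exact hw ((hwalk _ w rfl).mono (by omega))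
  obtain ⟨x, -, hx, hx'⟩ := hδ.exists_descent (rfl : δ w = δ w)
  have hspine : IsSpine A k x := by
    refine ⟨fun {i j} hi hj e => ?_, fun {i} hi => hx' i (by omega), fun {i j} hi hj hA => ?_⟩
    · rw [← hx i (by omega), ← hx j (by omega), e]
    · have := hδ.step hA
      rwa [hx i (by omega), hx j (by omega)] at this
  have hx0 : x 0 = v := (hδ.zero_iff _).1 (hx 0 (by omega))
  obtain ⟨ρ, hρ⟩ := exists_isLayering A {w | ∃ i ≤ k + 2, x i = w} fun w =>
    ⟨x 0, ⟨0, by omega, rfl⟩, hx0 ▸ hreach w⟩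
  have h : IsSpineLayering A k x ρ := ⟨hqt, hk, hko, hspine, hρ⟩
  exact absurd (h.four_le_ncard_kings hclosed (hx0 ▸ hvC) hno) (by omega)
end
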